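/- Let α be a join type-B composition of n and let π ∈ H_α. Then π has no type-B (α,231)-join pattern if and only if for all 1 ≤ i < k ≤ n the following implications hold: (a) if [i] ∈ Cov(π) (so necessarily i > α₁), then [j] ∈ Inv(π) for all α₁ < j < i whose α-region is strictly smaller than that of i; (b) if (i,k) ∈ Cov(π), then (i,j) ∈ Inv(π) for all i < j < k whose α-region lies strictly between those of i and k; (c) if (−k,i) ∈ Cov(π), then: [i] ∈ Inv(π) whenever i > α₁; (j,k) ∈ Inv(π) for all 1 ≤ j ≤ α₁ with j ≠ i; (−j,i) ∈ Inv(π) for all α₁ < j < k with j ≠ i; (j,i) ∈ Inv(π) for all 1 ≤ j ≤ α₁ whenever i > α₁; and (−k,j) ∈ Inv(π) for all α₁ < j < i. -/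

import Mathlib

namespace TypeB

/-- A sign-symmetric permutation of degree `n`: a bijection of `ℤ` with
`π(-i) = -π(i)` which fixes every integer of absolute value `> n`.
It restricts to a sign-symmetric permutation of `±[n]`. -/
structure SignedPerm (n : ℕ) where
  perm : Equiv.Perm ℤ
  sign_symm : ∀ i : ℤ, perm (-i) = - perm i
  outside : ∀ i : ℤ, (n : ℤ) < |i| → perm i = i

/-- Symbols for type-B inversions: `neg i` is `[i]`, `pair i j` (with `i < j`)
is `(i,j)`, and `mixed i j` (with `i < j`) is `(−j, i)`. -/
inductive BInv (n : ℕ) : Type where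
  | neg : ℕ → BInv n
  | pair : ℕ → ℕ → BInv n
  | mixed : ℕ → ℕ → BInv n
deriving DecidableEq

/-- `i⁺`: `i+1` if `i ≠ -1`, and `1` for `i = -1`. -/
def iplus (i : ℤ) : ℤ := if i = -1 then 1 else i + 1

/-- The inversion set of a sign-symmetric permutation. -/
def Inv {n : ℕ} (π : SignedPerm n) : Set (BInv n) := fun t =>
  match t with
  | .neg i => 1 ≤ i ∧ i ≤ n ∧ π.perm (i : ℤ) < 0
  | .pair i j => 1 ≤ i ∧ i < j ∧ j ≤ n ∧ π.perm (j : ℤ) < π.perm (i : ℤ)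
  | .mixed i j => 1 ≤ i ∧ i < j ∧ j ≤ n ∧ π.perm (i : ℤ) + π.perm (j : ℤ) < 0

/-- The cover-inversion set of a sign-symmetric permutation. -/
def Cov {n : ℕ} (π : SignedPerm n) : Set (BInv n) := fun t =>
  match t with
  | .neg i => 1 ≤ i ∧ i ≤ n ∧ π.perm (i : ℤ) = -1
  | .pair i j => 1 ≤ i ∧ i < j ∧ j ≤ n ∧ π.perm (i : ℤ) = iplus (π.perm (j : ℤ))
  | .mixed i j => 1 ≤ i ∧ i < j ∧ j ≤ n ∧ π.perm (-(j : ℤ)) = iplus (π.perm (i : ℤ))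

/-- The symbol `(−j, i)` in canonical form (it equals `(−i, j)`). -/
def mixedInv {n : ℕ} (i j : ℕ) : BInv n := .mixed (min i j) (max i j)

/-- A type-B composition of `n`: positive parts summing to `n`,
together with a split/join label. -/
structure BComp (n : ℕ) where
  parts : List ℕ
  pos : ∀ a ∈ parts, 0 < a
  sum_eq : parts.sum = n
  isJoin : Bool

/-- The partial sum `p_i = α₁ + ⋯ + α_i`. -/
def pSum {n : ℕ} (α : BComp n) (i : ℕ) : ℕ := (α.parts.take i).sum

/-- The α-region of `a ∈ [n]`: the unique `i` with `p_{i-1} < a ≤ p_i`. -/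
def region {n : ℕ} (α : BComp n) (a : ℕ) : ℕ :=
  ((Finset.range α.parts.length).filter (fun j => pSum α j < a)).card

/-- The first part `α₁` of a type-B composition. -/
def alpha1 {n : ℕ} (α : BComp n) : ℕ := α.parts.headI

/-- Index of the block of `Part(α)` containing `x ∈ ±[n]`; two elements lie in
a common block of `Part(α)` iff their indices agree. -/
def blockIdx {n : ℕ} (α : BComp n) (x : ℤ) : ℤ :=
  if 0 < x then
    (if α.isJoin = true ∧ region α x.toNat = 1 then 0 else (region α x.toNat : ℤ))
  else
    (if α.isJoin = true ∧ region α (-x).toNat = 1 then 0 else -(region α (-x).toNat : ℤ))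

/-- Membership in `±[n]`. -/
def inPM (n : ℕ) (x : ℤ) : Prop := x ≠ 0 ∧ -(n : ℤ) ≤ x ∧ x ≤ (n : ℤ)

/-- `π ∈ H_α`: `π` is increasing on every block of `Part(α)`. -/
def memH {n : ℕ} (α : BComp n) (π : SignedPerm n) : Prop :=
  ∀ a b : ℤ, inPM n a → inPM n b → a < b → blockIdx α a = blockIdx α b →
    π.perm a < π.perm b

/-- Common part of the type-B `(α,231)`- and `(α,312)`-patterns: indices
`i < j < k` in `±[n]`, in pairwise distinct blocks of `Part(α)`, with `j > 0`
and `π(i) = π(k)⁺`. -/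
def patternCore {n : ℕ} (α : BComp n) (π : SignedPerm n) (i j k : ℤ) : Prop :=
  inPM n i ∧ inPM n j ∧ inPM n k ∧ i < j ∧ j < k ∧ 0 < j ∧
  blockIdx α i ≠ blockIdx α j ∧ blockIdx α j ≠ blockIdx α k ∧
  blockIdx α i ≠ blockIdx α k ∧ π.perm i = iplus (π.perm k)

/-- `π` has a type-B `(α,231)`-split (resp. -join) pattern, according to the
label of `α`. -/
def has231 {n : ℕ} (α : BComp n) (π : SignedPerm n) : Prop :=
  ∃ i j k : ℤ, patternCore α π i j k ∧
    (if α.isJoin = true then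
       (((alpha1 α : ℤ) < j → π.perm i < π.perm j) ∧
        (j ≤ (alpha1 α : ℤ) → π.perm j < π.perm k))
     else π.perm i < π.perm j)

/-- `π` has a type-B `(α,312)`-split (resp. -join) pattern, according to the
label of `α`. -/
def has312 {n : ℕ} (α : BComp n) (π : SignedPerm n) : Prop :=
  ∃ i j k : ℤ, patternCore α π i j k ∧
    (if α.isJoin = true then
       (((alpha1 α : ℤ) < j → π.perm j < π.perm k) ∧
        (j ≤ (alpha1 α : ℤ) → π.perm i < π.perm j))
     else π.perm j < π.perm k)

/-- `π ∈ H_α(231)`. -/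
def mem231 {n : ℕ} (α : BComp n) (π : SignedPerm n) : Prop := memH α π ∧ ¬ has231 α π

/-- `π ∈ H_α(312)`. -/
def mem312 {n : ℕ} (α : BComp n) (π : SignedPerm n) : Prop := memH α π ∧ ¬ has312 α π

/-- The set `H_α`. -/
def Hset {n : ℕ} (α : BComp n) : Set (SignedPerm n) := {π | memH α π}

/-- The carrier of `Tam_B(α)`, namely `H_α(231)`. -/
def Tset {n : ℕ} (α : BComp n) : Set (SignedPerm n) := {π | mem231 α π}

/-- The weak order: inclusion of inversion sets. -/
def wle {n : ℕ} (π σ : SignedPerm n) : Prop := Inv π ⊆ Inv σ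

/-- `m` is the greatest lower bound of `x` and `y` within `P`, w.r.t. the weak order. -/
def isMeetIn {n : ℕ} (P : Set (SignedPerm n)) (x y m : SignedPerm n) : Prop :=
  m ∈ P ∧ wle m x ∧ wle m y ∧ ∀ z ∈ P, wle z x → wle z y → wle z m

/-- `u` is the least upper bound of `x` and `y` within `P`, w.r.t. the weak order. -/
def isJoinIn {n : ℕ} (P : Set (SignedPerm n)) (x y u : SignedPerm n) : Prop :=
  u ∈ P ∧ wle x u ∧ wle y u ∧ ∀ z ∈ P, wle x z → wle y z → wle u z

/-- `d = Π↓(π)`: `d` is the greatest element of `{σ ∈ H_α(231) : Inv σ ⊆ Inv π}`. -/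
def isProjDown {n : ℕ} (α : BComp n) (π d : SignedPerm n) : Prop :=
  mem231 α d ∧ wle d π ∧ ∀ σ, mem231 α σ → wle σ π → wle σ d

/-- `d = Π†(π)`: `d` is the greatest element of `{σ ∈ H_α(312) : Inv σ ⊆ Inv π}`. -/
def isProjDagger {n : ℕ} (α : BComp n) (π d : SignedPerm n) : Prop :=
  mem312 α d ∧ wle d π ∧ ∀ σ, mem312 α σ → wle σ π → wle σ d

/-- The value `ω_{o;α}(a)` for `a ∈ [n]`. -/
def omegaPos {n : ℕ} (α : BComp n) (a : ℕ) : ℤ :=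
  if α.isJoin = true ∧ region α a = 1 then (a : ℤ)
  else -(((pSum α (region α a) : ℤ) + (pSum α (region α a - 1) : ℤ) + 1) - (a : ℤ))

/-- The longest element `ω_{o;α}` of `H_α`, as a function on `ℤ`. -/
def omegaFun {n : ℕ} (α : BComp n) (x : ℤ) : ℤ :=
  if 0 < x ∧ x ≤ (n : ℤ) then omegaPos α x.toNat
  else if 0 < -x ∧ -x ≤ (n : ℤ) then -(omegaPos α (-x).toNat)
  else x

/-- The set of `m` such that there is a strict chain `x₀ < x₁ < ⋯ < x_m` in `P`. -/
def chainLengths {n : ℕ} (P : Set (SignedPerm n)) : Set ℕ :=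
  {m | ∃ f : Fin (m + 1) → SignedPerm n, (∀ i, f i ∈ P) ∧
        ∀ i j : Fin (m + 1), i < j → Inv (f i) ⊂ Inv (f j)}

/-- `x` is join-irreducible in `Tam_B(α)`. -/
def joinIrred {n : ℕ} (α : BComp n) (x : SignedPerm n) : Prop :=
  x ∈ Tset α ∧ ¬ (∀ y ∈ Tset α, wle x y) ∧
  ∀ y z, y ∈ Tset α → z ∈ Tset α → isJoinIn (Tset α) y z x → x = y ∨ x = z

/-- `x` is meet-irreducible in `Tam_B(α)`. -/
def meetIrred {n : ℕ} (α : BComp n) (x : SignedPerm n) : Prop :=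
  x ∈ Tset α ∧ ¬ (∀ y ∈ Tset α, wle y x) ∧
  ∀ y z, y ∈ Tset α → z ∈ Tset α → isMeetIn (Tset α) y z x → x = y ∨ x = z

/-- `x` is left modular in the lattice on `P`: `(r ∨ x) ∧ q = r ∨ (x ∧ q)`
for all `r ≤ q` in `P`. -/
def leftModular {n : ℕ} (P : Set (SignedPerm n)) (x : SignedPerm n) : Prop :=
  ∀ r q, r ∈ P → q ∈ P → wle r q →
    ∀ u v w1 w2, isJoinIn P r x u → isMeetIn P u q v →
      isMeetIn P x q w1 → isJoinIn P r w1 w2 → v = w2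

/-- The simple generator `s_i` as a function on `ℤ`: `s₀` exchanges `1` and `-1`,
and for `i ≥ 1`, `s_i` exchanges `i` with `i+1` and `-i` with `-(i+1)`. -/
def sfun (i : ℕ) (x : ℤ) : ℤ :=
  if i = 0 then (if x = 1 then -1 else if x = -1 then 1 else x)
  else if x = (i : ℤ) then (i : ℤ) + 1
  else if x = (i : ℤ) + 1 then (i : ℤ)
  else if x = -(i : ℤ) then -(i : ℤ) - 1
  else if x = -(i : ℤ) - 1 then -(i : ℤ)
  else x

/-- `i` is one of the partial sums `p₁, …, p_{r−1}` of `α`. -/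
def isPSum {n : ℕ} (α : BComp n) (i : ℕ) : Prop :=
  ∃ j : ℕ, 1 ≤ j ∧ j < α.parts.length ∧ pSum α j = i

/-- `n² − Σᵢ α_i(α_i−1)/2`, minus additionally `(α₁+1)α₁/2` when `α` is join. -/
def lengthFormula {n : ℕ} (α : BComp n) : ℕ :=
  n ^ 2 - (α.parts.map (fun a => a * (a - 1) / 2)).sum -
    (if α.isJoin = true then (alpha1 α + 1) * alpha1 α / 2 else 0)

theorem region_mono {n : ℕ} (α : BComp n) {a b : ℕ} (h : a ≤ b) :
    region α a ≤ region α b :=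
  Finset.card_le_card fun j hj => by
    simp only [Finset.mem_filter] at hj ⊢
    exact ⟨hj.1, hj.2.trans_le h⟩

theorem region_eq_one_of_le_alpha1 {n : ℕ} (α : BComp n) {a : ℕ} (ha : 1 ≤ a)
    (h : a ≤ alpha1 α) : region α a = 1 := by
  obtain ⟨parts, hpos, hsum, isJoin⟩ := α
  cases parts with
  | nil => simp [alpha1] at h; omega
  | cons p l =>
    simp only [alpha1, List.headI_cons] at h
    unfold region
    rw [Finset.card_eq_one]
    refine ⟨0, ?_⟩
    ext j
    rw [Finset.mem_filter, Finset.mem_range, Finset.mem_singleton]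
    cases j with
    | zero => simp [pSum]; omega
    | succ j => simp [pSum]; omega

theorem one_lt_region_of_alpha1_lt {n : ℕ} (α : BComp n) {a : ℕ} (han : a ≤ n)
    (h : alpha1 α < a) : 1 < region α a := by
  obtain ⟨parts, hpos, hsum, isJoin⟩ := α
  match parts with
  | [] => simp at hsum; omega
  | [p] => simp [alpha1] at h hsum; omega
  | p :: q :: l =>
    simp only [alpha1, List.headI_cons] at h
    unfold region
    rw [Finset.one_lt_card]
    refine ⟨0, ?_, 1, ?_, by simp⟩ <;> rw [Finset.mem_filter, Finset.mem_range]
    · simp [pSum]; omega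
    · simp [pSum]; omega

theorem blockIdx_neg {n : ℕ} (α : BComp n) {x : ℤ} (hx : 0 < x) :
    blockIdx α (-x) = -blockIdx α x := by
  have h : ¬ 0 < -x := by omega
  simp only [blockIdx, if_pos hx, if_neg h, neg_neg]
  split_ifs <;> simp

theorem blockIdx_of_le_alpha1 {n : ℕ} {α : BComp n} (hα : α.isJoin = true) {a : ℕ}
    (ha : 1 ≤ a) (h : a ≤ alpha1 α) : blockIdx α (a : ℤ) = 0 := by
  have := region_eq_one_of_le_alpha1 α ha h
  have h0 : 0 < a := ha
  simp [blockIdx, hα, this, h0]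

theorem blockIdx_of_alpha1_lt {n : ℕ} (α : BComp n) {a : ℕ} (han : a ≤ n)
    (h : alpha1 α < a) : blockIdx α (a : ℤ) = region α a := by
  have := one_lt_region_of_alpha1_lt α han h
  have h0 : 0 < a := by omega
  simp [blockIdx, h0]
  omega

namespace SignedPerm

variable {n : ℕ} {α : BComp n} {π : SignedPerm n}

theorem perm_ne {x y : ℤ} (h : x ≠ y) : π.perm x ≠ π.perm y := π.perm.injective.ne h

theorem perm_ne_zero {x : ℤ} (h : x ≠ 0) : π.perm x ≠ 0 := by
  have h0 := π.sign_symm 0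
  have h1 := perm_ne (π := π) h
  simp only [neg_zero] at h0
  omega

theorem perm_add_ne_zero {x y : ℤ} (h : x ≠ -y) : π.perm x + π.perm y ≠ 0 := by
  have h0 := π.sign_symm y
  have h1 := perm_ne (π := π) h
  omega

theorem perm_pos_of_le_alpha1 (hα : α.isJoin = true) (hπ : memH α π) {a : ℕ}
    (ha : 1 ≤ a) (han : a ≤ n) (h : a ≤ alpha1 α) : 0 < π.perm (a : ℤ) := by
  have hb := blockIdx_of_le_alpha1 hα ha h
  have hb' := blockIdx_neg α (x := (a : ℤ)) (by omega)
  have := hπ (-a) a (by unfold inPM; omega) (by unfold inPM; omega) (by omega) (by omega)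
  rw [π.sign_symm] at this
  omega

theorem perm_lt_of_region_eq (hπ : memH α π) {a b : ℕ} (ha : alpha1 α < a) (hab : a < b)
    (hb : b ≤ n) (h : region α a = region α b) : π.perm (a : ℤ) < π.perm (b : ℤ) := by
  have h1 := blockIdx_of_alpha1_lt α (by omega : a ≤ n) ha
  have h2 := blockIdx_of_alpha1_lt α hb (by omega)
  exact hπ a b (by unfold inPM; omega) (by unfold inPM; omega) (by omega) (by omega)

end SignedPerm

/-- `(-k, i)` with `i < k` is a cover inversion iff `π(i) + π(k) = -1`. -/
theorem mem_cov_mixed_iff {n : ℕ} {π : SignedPerm n} {i k : ℕ} :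
    BInv.mixed i k ∈ Cov π ↔
      1 ≤ i ∧ i < k ∧ k ≤ n ∧ π.perm (i : ℤ) + π.perm (k : ℤ) = -1 := by
  change (1 ≤ i ∧ i < k ∧ k ≤ n ∧ π.perm (-(k : ℤ)) = iplus (π.perm (i : ℤ))) ↔ _
  rw [π.sign_symm]
  unfold iplus
  constructor
  · rintro ⟨h1, h2, h3, h4⟩
    have := SignedPerm.perm_ne (π := π) (x := i) (y := k) (by omega)
    split_ifs at h4 <;> omega
  · rintro ⟨h1, h2, h3, h4⟩
    have := SignedPerm.perm_ne_zero (π := π) (x := (k : ℤ)) (by omega)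
    split_ifs <;> omega

theorem mem_inv_mixedInv_iff {n : ℕ} {π : SignedPerm n} {i j : ℕ} :
    mixedInv i j ∈ Inv π ↔
      1 ≤ i ∧ 1 ≤ j ∧ i ≠ j ∧ i ≤ n ∧ j ≤ n ∧ π.perm (i : ℤ) + π.perm (j : ℤ) < 0 := by
  change (1 ≤ min i j ∧ min i j < max i j ∧ max i j ≤ n ∧
    π.perm ((min i j : ℕ) : ℤ) + π.perm ((max i j : ℕ) : ℤ) < 0) ↔ _
  rcases le_total i j with h | h
  · rw [min_eq_left h, max_eq_right h]; omega
  · rw [min_eq_right h, max_eq_left h]; omega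

theorem blockIdx_cases {n : ℕ} {α : BComp n} (hα : α.isJoin = true) {a : ℕ} (ha : 1 ≤ a)
    (han : a ≤ n) :
    (a ≤ alpha1 α ∧ region α a = 1 ∧ blockIdx α (a : ℤ) = 0) ∨
      (alpha1 α < a ∧ 1 < region α a ∧ blockIdx α (a : ℤ) = region α a) := by
  rcases le_or_gt a (alpha1 α) with h | h
  · exact .inl ⟨h, region_eq_one_of_le_alpha1 α ha h, blockIdx_of_le_alpha1 hα ha h⟩
  · exact .inr ⟨h, one_lt_region_of_alpha1_lt α han h, blockIdx_of_alpha1_lt α han h⟩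

/-- The type-B `(α,231)`-join patterns by positive indices: the first index of the pattern
is positive, the negative of the third index, or any other negative index `-a`. -/
theorem has231_iff {n : ℕ} {α : BComp n} (hα : α.isJoin = true) {π : SignedPerm n}
    (hπ : memH α π) :
    has231 α π ↔
      (∃ i j k : ℕ, BInv.pair i k ∈ Cov π ∧ i < j ∧ j < k ∧ region α i < region α j ∧
        region α j < region α k ∧ π.perm (i : ℤ) < π.perm (j : ℤ)) ∨
      (∃ j k : ℕ, BInv.neg k ∈ Cov π ∧ alpha1 α < j ∧ j < k ∧ region α j < region α k ∧
        0 < π.perm (j : ℤ)) ∨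
      (∃ a b j : ℕ, ((a < b ∧ BInv.mixed a b ∈ Cov π) ∨ (b < a ∧ BInv.mixed b a ∈ Cov π)) ∧
        1 ≤ j ∧ j < b ∧ region α j < region α b ∧
        ((j ≤ alpha1 α ∧ alpha1 α < a ∧ π.perm (j : ℤ) < π.perm (b : ℤ)) ∨
          (alpha1 α < j ∧ 0 < π.perm (a : ℤ) + π.perm (j : ℤ)))) := by
  unfold has231
  simp only [hα, if_true]
  constructor
  · rintro ⟨i, j, k, ⟨hi, hj, hk, hij, hjk, hj0, h1, h2, h3, hcov⟩, h4, h5⟩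
    lift j to ℕ using by omega
    lift k to ℕ using by omega
    unfold inPM at hi hj hk
    have hjc := blockIdx_cases hα (a := j) (by omega) (by omega)
    have hkc := blockIdx_cases hα (a := k) (by omega) (by omega)
    have hjk' := region_mono α (a := j) (b := k) (by omega)
    rcases lt_or_ge i 0 with hi0 | hi0
    · obtain ⟨a, rfl⟩ : ∃ a : ℕ, i = -(a : ℤ) := ⟨i.natAbs, by omega⟩
      have hac := blockIdx_cases hα (a := a) (by omega) (by omega)
      rw [blockIdx_neg α (by omega)] at h1 h3
      have hs := π.sign_symm a
      rcases lt_trichotomy a k with hak | rfl | hak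
      · have hm : BInv.mixed a k ∈ Cov π := mem_cov_mixed_iff.2 (by
          have := SignedPerm.perm_ne (π := π) (x := a) (y := k) (by omega)
          unfold iplus at hcov
          split_ifs at hcov <;> omega)
        exact .inr (.inr ⟨a, k, j, .inl ⟨hak, hm⟩, by omega⟩)
      · have hm : π.perm (a : ℤ) = -1 := by
          unfold iplus at hcov
          split_ifs at hcov <;> omega
        have hj1 : j ≤ alpha1 α → 0 < π.perm (j : ℤ) :=
          SignedPerm.perm_pos_of_le_alpha1 hα hπ (by omega) (by omega)
        exact .inr (.inl ⟨j, a, ⟨by omega, by omega, hm⟩, by omega⟩)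
      · have hm : BInv.mixed k a ∈ Cov π := mem_cov_mixed_iff.2 (by
          have := SignedPerm.perm_ne (π := π) (x := a) (y := k) (by omega)
          unfold iplus at hcov
          split_ifs at hcov <;> omega)
        exact .inr (.inr ⟨a, k, j, .inr ⟨hak, hm⟩, by omega⟩)
    · lift i to ℕ using hi0
      have hic := blockIdx_cases hα (a := i) (by omega) (by omega)
      have hij' := region_mono α (a := i) (b := j) (by omega)
      exact .inl ⟨i, j, k, ⟨by omega, by omega, by omega, hcov⟩, by omega⟩
  · rintro (⟨i, j, k, ⟨hi, hik, hk, hcov⟩, hij, hjk, hr, hr', hlt⟩ |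
      ⟨j, k, ⟨hk0, hk, hcov⟩, hj, hjk, hr, hlt⟩ | ⟨a, b, j, hab, hj, hjb, hr, h⟩)
    · have hic := blockIdx_cases hα (a := i) (by omega) (by omega)
      have hjc := blockIdx_cases hα (a := j) (by omega) (by omega)
      have hkc := blockIdx_cases hα (a := k) (by omega) (by omega)
      refine ⟨i, j, k, ⟨?_, ?_, ?_, ?_, ?_, ?_, ?_, ?_, ?_, hcov⟩, ?_, ?_⟩ <;>
        first | omega | (unfold inPM; omega)
    · have hjc := blockIdx_cases hα (a := j) (by omega) (by omega)
      have hkc := blockIdx_cases hα (a := k) (by omega) (by omega)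
      have hs := π.sign_symm k
      have hne := SignedPerm.perm_add_ne_zero (π := π) (x := j) (y := k) (by omega)
      refine ⟨-k, j, k, ⟨?_, ?_, ?_, ?_, ?_, ?_, ?_, ?_, ?_, ?_⟩, ?_, ?_⟩ <;>
        try rw [blockIdx_neg α (by omega)]
      all_goals first | omega | (unfold inPM; omega) | skip
      rw [hs, hcov]
      simp [iplus]
    · have hab' : 1 ≤ a ∧ a ≤ n ∧ b ≤ n ∧ a ≠ b ∧
          π.perm (a : ℤ) + π.perm (b : ℤ) = -1 := by
        rcases hab with ⟨h, hm⟩ | ⟨h, hm⟩ <;> have := mem_cov_mixed_iff.1 hm <;> omega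
      have hac := blockIdx_cases hα (a := a) (by omega) (by omega)
      have hjc := blockIdx_cases hα (a := j) (by omega) (by omega)
      have hbc := blockIdx_cases hα (a := b) (by omega) (by omega)
      have hs := π.sign_symm a
      have hne := SignedPerm.perm_ne_zero (π := π) (x := a) (by omega)
      refine ⟨-a, j, b, ⟨?_, ?_, ?_, ?_, ?_, ?_, ?_, ?_, ?_, ?_⟩, ?_, ?_⟩ <;>
        try rw [blockIdx_neg α (by omega)]
      all_goals first | omega | (unfold inPM; omega) | skip
      unfold iplus
      split_ifs <;> omega

/-- For a join type-B composition `α` and `π ∈ H_α`: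
`π` has no type-B `(α,231)`-join pattern iff the forcing conditions
(a)–(c) of Lemma (join case) hold. -/
theorem no_join_231_iff_forcing (n : ℕ) (hn : 1 ≤ n) (α : BComp n)
    (hjoin : α.isJoin = true) (π : SignedPerm n) (hπ : memH α π) :
    ¬ has231 α π ↔
      ((∀ i : ℕ, BInv.neg i ∈ Cov π →
          ∀ j : ℕ, alpha1 α < j → j < i → region α j < region α i →
            BInv.neg j ∈ Inv π) ∧
       (∀ i k : ℕ, BInv.pair i k ∈ Cov π →
          ∀ j : ℕ, i < j → j < k →
            region α i < region α j → region α j < region α k →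
            BInv.pair i j ∈ Inv π) ∧
       (∀ i k : ℕ, BInv.mixed i k ∈ Cov π →
          (alpha1 α < i → BInv.neg i ∈ Inv π) ∧
          (∀ j : ℕ, 1 ≤ j → j ≤ alpha1 α → j ≠ i → BInv.pair j k ∈ Inv π) ∧
          (∀ j : ℕ, alpha1 α < j → j < k → j ≠ i → mixedInv i j ∈ Inv π) ∧
          (∀ j : ℕ, 1 ≤ j → j ≤ alpha1 α → alpha1 α < i → BInv.pair j i ∈ Inv π) ∧
          (∀ j : ℕ, alpha1 α < j → j < i → BInv.mixed j k ∈ Inv π))) := by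
  rw [has231_iff hjoin hπ]
  constructor
  · intro hno
    refine ⟨fun i hi j hj hji hr => ?_, fun i k hik j hij hjk hr hr' => ?_,
      fun i k hik => ?_⟩
    · have hi' := hi
      obtain ⟨h1, h2, h3⟩ := hi'
      by_contra hinv
      have h0 := SignedPerm.perm_ne_zero (π := π) (x := j) (by omega)
      exact hno (.inr (.inl ⟨j, i, hi, hj, hji, hr, by
        by_contra h
        exact hinv ⟨by omega, by omega, by omega⟩⟩))
    · have hik' := hik
      obtain ⟨h1, h2, h3, -⟩ := hik'
      by_contra hinv
      have h0 := SignedPerm.perm_ne (π := π) (x := i) (y := j) (by omega)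
      exact hno (.inl ⟨i, j, k, hik, hij, hjk, hr, hr', by
        by_contra h
        exact hinv ⟨by omega, by omega, by omega, by omega⟩⟩)
    · obtain ⟨h1, h2, h3, hsum⟩ := mem_cov_mixed_iff.1 hik
      have hpos : ∀ j : ℕ, 1 ≤ j → j ≤ n → j ≤ alpha1 α → 0 < π.perm (j : ℤ) :=
        fun j => SignedPerm.perm_pos_of_le_alpha1 hjoin hπ
      have hi1 := hpos i h1 (by omega)
      have hk1 := hpos k (by omega) (by omega)
      have hkα : alpha1 α < k := by omega
      have hrk := one_lt_region_of_alpha1_lt α h3 hkα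
      have hi0 := SignedPerm.perm_ne_zero (π := π) (x := i) (by omega)
      have hineg : alpha1 α < i → π.perm (i : ℤ) < 0 := by
        intro hi
        by_contra h
        have hmono := region_mono α h2.le
        have hlt := SignedPerm.perm_lt_of_region_eq hπ hi h2 h3
        exact hno (.inr (.inr ⟨i, k, i, .inl ⟨h2, hik⟩, h1, h2, by omega, by omega⟩))
      refine ⟨fun hi => ⟨h1, by omega, hineg hi⟩, fun j hj hjα hji => ?_,
        fun j hj hjk hji => ?_, fun j hj hjα hi => ?_, fun j hj hji => ?_⟩
      · refine ⟨hj, by omega, h3, ?_⟩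
        have hj1 := hpos j hj (by omega) hjα
        have hrj := region_eq_one_of_le_alpha1 α hj hjα
        have h0 := SignedPerm.perm_ne (π := π) (x := j) (y := k) (by omega)
        by_contra h
        exact hno (.inr (.inr ⟨i, k, j, .inl ⟨h2, hik⟩, hj, by omega, by omega, by omega⟩))
      · refine mem_inv_mixedInv_iff.2 ⟨h1, by omega, hji.symm, by omega, by omega, ?_⟩
        have h0 := SignedPerm.perm_add_ne_zero (π := π) (x := i) (y := j) (by omega)
        have hmono := region_mono α hjk.le
        have hlt := SignedPerm.perm_lt_of_region_eq hπ hj hjk h3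
        by_contra h
        exact hno (.inr (.inr ⟨i, k, j, .inl ⟨h2, hik⟩, by omega, hjk, by omega, by omega⟩))
      · refine ⟨hj, by omega, by omega, ?_⟩
        have hrj := region_eq_one_of_le_alpha1 α hj hjα
        have hri := one_lt_region_of_alpha1_lt α (by omega) hi
        have h0 := SignedPerm.perm_ne (π := π) (x := j) (y := i) (by omega)
        by_contra h
        exact hno (.inr (.inr ⟨k, i, j, .inr ⟨h2, hik⟩, hj, by omega, by omega, by omega⟩))
      · refine ⟨by omega, by omega, h3, ?_⟩
        have h0 := SignedPerm.perm_add_ne_zero (π := π) (x := j) (y := k) (by omega)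
        have hmono := region_mono α hji.le
        have hlt := SignedPerm.perm_lt_of_region_eq hπ hj hji (by omega)
        by_contra h
        exact hno (.inr (.inr ⟨k, i, j, .inr ⟨h2, hik⟩, by omega, hji, by omega, by omega⟩))
  · rintro ⟨ha, hb, hc⟩ (⟨i, j, k, hik, hij, hjk, hr, hr', hlt⟩ |
      ⟨j, k, hk, hj, hjk, hr, hlt⟩ | ⟨a, b, j, ⟨hab, hm⟩ | ⟨hab, hm⟩, hj, hjb, hr, h⟩)
    · obtain ⟨-, -, -, h⟩ := hb i k hik j hij hjk hr hr'
      omega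
    · obtain ⟨-, -, h⟩ := ha k hk j hj hjk hr
      omega
    · obtain ⟨c1, c2, c3, -, -⟩ := hc a b hm
      rcases h with ⟨hjα, haα, h⟩ | ⟨hjα, h⟩
      · obtain ⟨-, -, -, h'⟩ := c2 j hj hjα (by omega)
        omega
      · rcases eq_or_ne j a with rfl | hja
        · obtain ⟨-, -, h'⟩ := c1 hjα
          omega
        · have h' := mem_inv_mixedInv_iff.1 (c3 j hjα hjb hja)
          omega
    · obtain ⟨-, -, -, c4, c5⟩ := hc b a hm
      rcases h with ⟨hjα, haα, h⟩ | ⟨hjα, h⟩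
      · have hbα : alpha1 α < b := by
          by_contra hb'
          have h1 := region_eq_one_of_le_alpha1 α (by omega) (not_lt.1 hb')
          have h2 := region_eq_one_of_le_alpha1 α hj hjα
          omega
        obtain ⟨-, -, -, h'⟩ := c4 j hj hjα hbα
        omega
      · obtain ⟨-, -, -, h'⟩ := c5 j hjα hjb
        omega


end TypeB
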